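/- Let ω ∈ ℝᵈ satisfy the Diophantine condition with constants γ > 0 and τ > d−1, let 1 < κ < 2, ρ₀ > 0, 0 < c₀ < 1/4, and set τ_m = τκᵐ and ν_m = c₀ρ₀/(4(m+1)²) for m ∈ ℕ. For δ > 0 define ℛ^{(m)}(δ) = {φ ∈ (0,δ) : ∃ k ∈ ℤᵈ∖{0} with |⟨k,ω⟩ − φ| < (γ/2)|k|^{−τ_m} e^{−ν_m|k|}} and ℛ(δ) = ⋃_{m=0}^∞ ℛ^{(m)}(δ). Then there exist constants a₁ > 0 and 0 < a₂ < 1/τ such that for all sufficiently small δ > 0, the Lebesgue measure of ℛ(δ) satisfies Meas(ℛ(δ)) ≤ δ · exp(−a₁/δ^{a₂}). -/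

import Mathlib

open Filter Set MeasureTheory Topology

noncomputable section

/-- ℓ¹ norm `|k| = |k₁| + ⋯ + |k_d|` of an integer vector. -/
def knorm {d : ℕ} (k : Fin d → ℤ) : ℝ := ∑ i, |(k i : ℝ)|

/-- `⟨k, ω⟩ = k₁ω₁ + ⋯ + k_dω_d`. -/
def kdot {d : ℕ} (k : Fin d → ℤ) (ω : Fin d → ℝ) : ℝ := ∑ i, (k i : ℝ) * ω i

/-- The Diophantine condition `|⟨k,ω⟩| ≥ γ |k|^{-τ}` for all `k ∈ ℤᵈ \ {0}`. -/
def Diophantine {d : ℕ} (ω : Fin d → ℝ) (γ τ : ℝ) : Prop :=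
  ∀ k : Fin d → ℤ, k ≠ 0 → γ * knorm k ^ (-τ) ≤ |kdot k ω|

/-- The resonant set `ℛ^{(m)}(δ)` at step `m` of the KAM iteration. -/
def resonantSet (d : ℕ) (ω : Fin d → ℝ) (γ : ℝ) (τm νm : ℝ) (δ : ℝ) : Set ℝ :=
  {φ ∈ Ioo (0:ℝ) δ | ∃ k : Fin d → ℤ, k ≠ 0 ∧
    |kdot k ω - φ| < γ / 2 * knorm k ^ (-τm) * Real.exp (-νm * knorm k)}

lemma knorm_nonneg {d : ℕ} (k : Fin d → ℤ) : 0 ≤ knorm k :=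
  Finset.sum_nonneg fun _ _ => abs_nonneg _

lemma abs_le_knorm {d : ℕ} (k : Fin d → ℤ) (i : Fin d) : |(k i : ℝ)| ≤ knorm k :=
  Finset.single_le_sum (f := fun i => |(k i : ℝ)|) (fun _ _ => abs_nonneg _) (Finset.mem_univ i)

lemma one_le_knorm {d : ℕ} {k : Fin d → ℤ} (hk : k ≠ 0) : 1 ≤ knorm k := by
  obtain ⟨i, hi⟩ := Function.ne_iff.mp hk
  have h : (1 : ℤ) ≤ |k i| := Int.one_le_abs hi
  have h' : (1 : ℝ) ≤ |(k i : ℝ)| := by exact_mod_cast h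
  exact h'.trans (abs_le_knorm k i)

lemma summable_exp_neg_sqrt_abs_int {a : ℝ} (ha : 0 < a) :
    Summable fun n : ℤ => Real.exp (-a * √|(n : ℝ)|) := by
  have hs : Summable fun n : ℤ => 24 / a ^ 4 * (1 / (n : ℝ) ^ 2) :=
    (Real.summable_one_div_int_pow.mpr one_lt_two).mul_left _
  refine hs.of_norm_bounded_eventually ?_
  filter_upwards [(Set.finite_singleton (0 : ℤ)).compl_mem_cofinite] with n hn
  have hn' : (0 : ℝ) < |(n : ℝ)| := abs_pos.mpr (by exact_mod_cast hn)
  have h := Real.pow_div_factorial_le_exp (a * √|(n : ℝ)|) (by positivity) 4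
  have h4 : √|(n : ℝ)| ^ 4 = (n : ℝ) ^ 2 := by
    rw [show 4 = 2 * 2 from rfl, pow_mul, Real.sq_sqrt hn'.le, sq_abs]
  have hn2 : 0 < (n : ℝ) ^ 2 := by rw [← sq_abs]; positivity
  rw [mul_pow, h4] at h
  rw [Real.norm_of_nonneg (Real.exp_nonneg _), neg_mul, Real.exp_neg]
  calc (Real.exp (a * √|(n : ℝ)|))⁻¹
      ≤ (a ^ 4 * (n : ℝ) ^ 2 / (Nat.factorial 4 : ℝ))⁻¹ := by
        gcongr
    _ = 24 / a ^ 4 * (1 / (n : ℝ) ^ 2) := by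
        norm_num [Nat.factorial]
        field_simp

lemma summable_fin_pi_prod {α : Type*} {f : α → ℝ} (hf : Summable f) (h0 : ∀ x, 0 ≤ f x) (d : ℕ) :
    Summable fun k : Fin d → α => ∏ i, f (k i) := by
  induction d with
  | zero => exact (hasSum_fintype _).summable
  | succ d ih =>
    rw [← (Fin.consEquiv fun _ => α).summable_iff]
    refine (hf.mul_of_nonneg ih h0 fun k => Finset.prod_nonneg fun i _ => h0 _).congr ?_
    intro p
    simp [Fin.consEquiv, Fin.prod_univ_succ]

lemma summable_exp_neg_sqrt_knorm {d : ℕ} (hd : 0 < d) {a : ℝ} (ha : 0 < a) :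
    Summable fun k : Fin d → ℤ => Real.exp (-a * √(knorm k)) := by
  have hd' : (0 : ℝ) < d := by exact_mod_cast hd
  refine Summable.of_nonneg_of_le (fun _ => Real.exp_nonneg _) (fun k => ?_)
    (summable_fin_pi_prod (summable_exp_neg_sqrt_abs_int (div_pos ha hd'))
      (fun _ => Real.exp_nonneg _) d)
  rw [← Real.exp_sum, ← Finset.mul_sum, Real.exp_le_exp]
  have h : ∑ i, √|(k i : ℝ)| ≤ d * √(knorm k) := by
    simpa using Finset.sum_le_card_nsmul Finset.univ (fun i => √|(k i : ℝ)|) (√(knorm k))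
      fun i _ => Real.sqrt_le_sqrt (abs_le_knorm k i)
  calc -a * √(knorm k) = -(a / d) * (d * √(knorm k)) := by field_simp
    _ ≤ _ := mul_le_mul_of_nonpos_left h (by simp; positivity)

/-- An exponential dominates a quadratic polynomial, uniformly in the exponent. -/
lemma exists_mul_sq_le_pow {κ : ℝ} (hκ : 1 < κ) :
    ∃ C > 0, ∀ m : ℕ, C * ((m : ℝ) + 1) ^ 2 ≤ κ ^ m := by
  obtain ⟨M, hM⟩ := (tendsto_pow_const_div_const_pow_of_one_lt 2 hκ).bddAbove_range
  have hκ0 : 0 < κ := by linarith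
  have hM0 : 0 < max M 1 := by positivity
  refine ⟨1 / (max M 1 * κ), by positivity, fun m => ?_⟩
  have h := (hM ⟨m + 1, rfl⟩).trans (le_max_left M 1)
  simp only [Nat.cast_add, Nat.cast_one] at h
  rw [div_le_iff₀ (by positivity), pow_succ κ] at h
  rw [one_div_mul_eq_div, div_le_iff₀ (by positivity)]
  linarith

lemma add_le_add_div_sq {B c n s T : ℝ} (hB : 0 < B) (hc : 0 < c) (hn : 0 ≤ n) (hs : 1 ≤ s)
    (hT : 2 * B * s ^ 2 ≤ T) : 2 * √(B * c) * √n + B * s ≤ T + c / s ^ 2 * n := by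
  have hs0 : 0 < s := by linarith
  have h1 := two_mul_le_add_sq (√B * s) (√(c * n) / s)
  have h2 : (√B * s) ^ 2 = B * s ^ 2 := by rw [mul_pow, Real.sq_sqrt hB.le]
  have h3 : (√(c * n) / s) ^ 2 = c / s ^ 2 * n := by
    rw [div_pow, Real.sq_sqrt (by positivity)]; ring
  have h4 : 2 * (√B * s) * (√(c * n) / s) = 2 * √(B * c) * √n := by
    rw [Real.sqrt_mul hc.le, Real.sqrt_mul hB.le]; field_simp
  nlinarith [mul_nonneg hB.le (mul_nonneg hs0.le (sub_nonneg.mpr hs))]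

/-- The decay of the resonance widths in the step and in the frequency vector, decoupled. -/
lemma rpow_neg_mul_exp_le {B c n s T : ℝ} (hB : 0 < B) (hc : 0 < c) (hn : 3 ≤ n) (hs : 1 ≤ s)
    (hT : 2 * B * s ^ 2 ≤ T) :
    n ^ (-T) * Real.exp (-(c / s ^ 2) * n)
      ≤ Real.exp (-(2 * √(B * c)) * √n) * Real.exp (-B * s) := by
  have hT0 : 0 ≤ T := le_trans (by positivity) hT
  have hlog : 1 ≤ Real.log n := by
    rw [Real.le_log_iff_exp_le (by linarith)]
    exact Real.exp_one_lt_three.le.trans hn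
  rw [Real.rpow_def_of_pos (by linarith), ← Real.exp_add, ← Real.exp_add, Real.exp_le_exp]
  nlinarith [add_le_add_div_sq hB hc (by linarith : 0 ≤ n) hs hT,
    mul_le_mul_of_nonneg_right hlog hT0]

/-- Only large frequency vectors resonate with small `φ`. -/
lemma knorm_rpow_neg_lt_of_resonant {d : ℕ} {ω : Fin d → ℝ} {γ τ T ν δ φ : ℝ} (hγ : 0 < γ)
    (hdio : Diophantine ω γ τ) (hT : τ ≤ T) (hν : 0 ≤ ν) (hφ : φ ∈ Ioo 0 δ)
    {k : Fin d → ℤ} (hk : k ≠ 0)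
    (h : |kdot k ω - φ| < γ / 2 * knorm k ^ (-T) * Real.exp (-ν * knorm k)) :
    knorm k ^ (-τ) < 2 * δ / γ := by
  have h1 := one_le_knorm hk
  have h2 : knorm k ^ (-T) ≤ knorm k ^ (-τ) :=
    Real.rpow_le_rpow_of_exponent_le h1 (neg_le_neg hT)
  have h3 : Real.exp (-ν * knorm k) ≤ 1 :=
    Real.exp_le_one_iff.mpr (by nlinarith)
  have h4 : γ / 2 * knorm k ^ (-T) * Real.exp (-ν * knorm k) ≤ γ / 2 * knorm k ^ (-τ) := by
    have h5 : 0 ≤ γ / 2 * knorm k ^ (-T) :=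
      mul_nonneg (by positivity) (Real.rpow_nonneg (knorm_nonneg k) _)
    exact (mul_le_of_le_one_right h5 h3).trans (by gcongr)
  have h6 : |kdot k ω| ≤ |kdot k ω - φ| + φ := by
    have := abs_add_le (kdot k ω - φ) φ
    rwa [sub_add_cancel, abs_of_pos hφ.1] at this
  rw [lt_div_iff₀ hγ]
  linarith [hdio k hk, hφ.2]

lemma volume_le_tsum_of_subset_iUnion_ball {ι : Type*} [Countable ι] {s : Set ℝ} {P : ι → Prop}
    {x r g : ι → ℝ} (hg : Summable g) (hg0 : ∀ i, 0 ≤ g i) (hr : ∀ i, P i → 2 * r i ≤ g i)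
    (hs : ∀ y ∈ s, ∃ i, P i ∧ y ∈ Metric.ball (x i) (r i)) :
    volume s ≤ ENNReal.ofReal (∑' i, g i) := by
  rw [ENNReal.ofReal_tsum_of_nonneg hg0 hg]
  have hsub : s ⊆ ⋃ i, {y | P i ∧ y ∈ Metric.ball (x i) (r i)} := fun y hy =>
    mem_iUnion.mpr (hs y hy)
  refine (measure_mono hsub).trans ((measure_iUnion_le _).trans (ENNReal.tsum_le_tsum fun i => ?_))
  by_cases hi : P i
  · refine (measure_mono fun y hy => hy.2).trans ?_
    rw [Real.volume_ball]
    exact ENNReal.ofReal_le_ofReal (hr i hi)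
  · simp [hi]

lemma eventually_mul_exp_neg_div_rpow_le {Q a p : ℝ} (ha : 0 < a) (hp : 0 < p) :
    ∀ᶠ δ in 𝓝[>] (0 : ℝ),
      Q * Real.exp (-(2 * a) / δ ^ p) ≤ δ * Real.exp (-a / δ ^ p) := by
  have h1 : Tendsto (fun δ : ℝ => δ ^ (-p)) (𝓝[>] 0) atTop :=
    tendsto_rpow_neg_nhdsGT_zero (neg_lt_zero.mpr hp)
  have h2 := ((tendsto_rpow_mul_exp_neg_mul_atTop_nhds_zero (1 / p) a ha).comp h1).const_mul Q
  rw [mul_zero] at h2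
  filter_upwards [h2.eventually_le_const one_pos, self_mem_nhdsWithin] with δ h hδ
  have hδ0 : (0 : ℝ) < δ := hδ
  simp only [Function.comp] at h
  rw [← Real.rpow_mul hδ0.le, show -p * (1 / p) = -1 by field_simp, Real.rpow_neg_one,
    Real.rpow_neg hδ0.le, ← div_eq_mul_inv] at h
  have h3 : Q * Real.exp (-a / δ ^ p) ≤ δ := by
    calc _ = δ * (Q * (δ⁻¹ * Real.exp (-a / δ ^ p))) := by field_simp
      _ ≤ δ * 1 := by gcongr
      _ = δ := mul_one _
  rw [show -(2 * a) / δ ^ p = -a / δ ^ p + -a / δ ^ p by ring, Real.exp_add, ← mul_assoc]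
  gcongr

/-- **Lemma 2.6.** Measure estimate for the union of all resonant sets
`ℛ(δ) = ⋃ₘ ℛ^{(m)}(δ)`, with `τ_m = τκᵐ` and `ν_m = c₀ρ₀/(4(m+1)²)`:
`Meas(ℛ(δ)) ≤ δ exp(-a₁/δ^{a₂})` for all small `δ`. -/
theorem resonant_set_measure_estimate
    (d : ℕ) (hd : 0 < d)
    (ω : Fin d → ℝ) (γ τ : ℝ) (hγ : 0 < γ) (hτ : (d : ℝ) - 1 < τ)
    (hdio : Diophantine ω γ τ)
    (κ ρ₀ c₀ : ℝ) (hκ : 1 < κ) (hκ2 : κ < 2) (hρ₀ : 0 < ρ₀)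
    (hc₀ : 0 < c₀) (hc₀' : c₀ < 1 / 4) :
    ∃ a₁ > (0:ℝ), ∃ a₂ ∈ Ioo (0:ℝ) (1 / τ), ∃ δ₀ > (0:ℝ), ∀ δ ∈ Ioo (0:ℝ) δ₀,
      volume (⋃ m : ℕ,
        resonantSet d ω γ (τ * κ ^ m) (c₀ * ρ₀ / (4 * ((m : ℝ) + 1) ^ 2)) δ)
      ≤ ENNReal.ofReal (δ * Real.exp (-a₁ / δ ^ a₂)) := by
  have hτ0 : 0 < τ := by
    have : (1 : ℝ) ≤ d := by exact_mod_cast hd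
    linarith
  obtain ⟨C, hC, hCκ⟩ := exists_mul_sq_le_pow hκ
  set B := τ * C / 2 with hB_def
  set c := c₀ * ρ₀ / 4 with hc_def
  have hB : 0 < B := by positivity
  have hc : 0 < c := by positivity
  set A := √(B * c)
  have hA : 0 < A := by positivity
  set p := 1 / (2 * τ) with hp_def
  have hp : 0 < p := by positivity
  set a := A * (γ / 2) ^ p / 2 with ha_def
  have ha : 0 < a := by positivity
  have hg : Summable fun i : ℕ × (Fin d → ℤ) =>
      Real.exp (-B * ((i.1 : ℝ) + 1)) * Real.exp (-A * √(knorm i.2)) := by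
    refine Summable.mul_of_nonneg (f := fun m : ℕ => Real.exp (-B * ((m : ℝ) + 1))) ?_
      (summable_exp_neg_sqrt_knorm hd hA) (fun _ => Real.exp_nonneg _) fun _ => Real.exp_nonneg _
    have h := Real.summable_exp_nat_mul_iff.mpr (neg_lt_zero.mpr hB)
    refine (h.mul_right (Real.exp (-B))).congr fun m => ?_
    rw [← Real.exp_add]
    ring_nf
  set S := ∑' i : ℕ × (Fin d → ℤ),
      Real.exp (-B * ((i.1 : ℝ) + 1)) * Real.exp (-A * √(knorm i.2)) with hS
  have hsmall : ∀ᶠ δ in 𝓝[>] (0 : ℝ), δ < γ / 2 * (3 : ℝ) ^ (-τ) :=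
    nhdsWithin_le_nhds (eventually_lt_nhds (by positivity))
  obtain ⟨δ₀, hδ₀, hev⟩ := mem_nhdsGT_iff_exists_Ioo_subset.mp
    (hsmall.and (eventually_mul_exp_neg_div_rpow_le (Q := γ * S) ha hp))
  refine ⟨a, ha, p, ⟨hp, ?_⟩, δ₀, hδ₀, fun δ hδ => ?_⟩
  · exact one_div_lt_one_div_of_lt hτ0 (by linarith)
  obtain ⟨hδ3, hfin⟩ := hev hδ
  have hδ0 : 0 < δ := hδ.1
  refine le_trans ?_ (ENNReal.ofReal_le_ofReal hfin)
  have hQ : γ * S * Real.exp (-(2 * a) / δ ^ p) = ∑' i : ℕ × (Fin d → ℤ),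
      γ * Real.exp (-(2 * a) / δ ^ p) *
        (Real.exp (-B * ((i.1 : ℝ) + 1)) * Real.exp (-A * √(knorm i.2))) := by
    rw [tsum_mul_left, ← hS]
    ring
  rw [hQ]
  refine volume_le_tsum_of_subset_iUnion_ball (hg.mul_left _) (fun _ => by positivity)
    (P := fun i => knorm i.2 ^ (-τ) < 2 * δ / γ ∧ i.2 ≠ 0) (x := fun i => kdot i.2 ω)
    (r := fun i => γ / 2 * knorm i.2 ^ (-(τ * κ ^ i.1)) *
      Real.exp (-(c₀ * ρ₀ / (4 * ((i.1 : ℝ) + 1) ^ 2)) * knorm i.2)) ?_ ?_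
  · rintro ⟨m, k⟩ ⟨hk, hk0⟩
    dsimp only at hk hk0 ⊢
    have hn1 := one_le_knorm hk0
    have hn0 : 0 < knorm k := by linarith
    have hn3 : 3 ≤ knorm k := by
      have h3 : 2 * δ / γ < (3 : ℝ) ^ (-τ) := by
        rw [div_lt_iff₀ hγ]
        linarith
      exact ((Real.rpow_lt_rpow_iff_of_neg hn0 three_pos (neg_lt_zero.mpr hτ0)).mp
        (hk.trans h3)).le
    have hsqrt : (γ / 2) ^ p / δ ^ p ≤ √(knorm k) := by
      have h1 : γ / 2 / δ ≤ knorm k ^ τ := by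
        rw [Real.rpow_neg hn0.le, inv_lt_comm₀ (by positivity) (by positivity), inv_div] at hk
        rw [div_div]
        exact hk.le
      calc (γ / 2) ^ p / δ ^ p = (γ / 2 / δ) ^ p := (Real.div_rpow (by positivity) hδ0.le _).symm
        _ ≤ (knorm k ^ τ) ^ p := by gcongr
        _ = √(knorm k) := by
          rw [← Real.rpow_mul hn0.le, Real.sqrt_eq_rpow, hp_def]
          congr 1
          field_simp
    have hdecay := rpow_neg_mul_exp_le (s := (m : ℝ) + 1) (T := τ * κ ^ m) hB hc hn3
      (by simp) (by
        have := mul_le_mul_of_nonneg_left (hCκ m) hτ0.le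
        rw [hB_def]
        linarith)
    rw [show c₀ * ρ₀ / (4 * ((m : ℝ) + 1) ^ 2) = c / ((m : ℝ) + 1) ^ 2 by
      rw [hc_def, div_div]]
    have hexp : Real.exp (-(2 * A) * √(knorm k))
        ≤ Real.exp (-(2 * a) / δ ^ p) * Real.exp (-A * √(knorm k)) := by
      rw [← Real.exp_add, Real.exp_le_exp]
      have h2a : -(2 * a) / δ ^ p = -(A * ((γ / 2) ^ p / δ ^ p)) := by
        rw [ha_def]
        ring
      rw [h2a]
      linarith [mul_le_mul_of_nonneg_left hsqrt hA.le]
    calc _ = γ * (knorm k ^ (-(τ * κ ^ m)) *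
          Real.exp (-(c / ((m : ℝ) + 1) ^ 2) * knorm k)) := by ring
      _ ≤ γ * (Real.exp (-(2 * A) * √(knorm k)) * Real.exp (-B * ((m : ℝ) + 1))) := by gcongr
      _ ≤ γ * ((Real.exp (-(2 * a) / δ ^ p) * Real.exp (-A * √(knorm k))) *
          Real.exp (-B * ((m : ℝ) + 1))) := by gcongr
      _ = _ := by ring
  · intro φ hφ
    obtain ⟨m, hφδ, k, hk0, hk⟩ := mem_iUnion.mp hφ
    refine ⟨(m, k), ⟨knorm_rpow_neg_lt_of_resonant hγ hdio ?_ ?_ hφδ hk0 hk, hk0⟩, ?_⟩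
    · exact le_mul_of_one_le_right hτ0.le (one_le_pow₀ hκ.le)
    · positivity
    · rwa [mem_ball_iff_norm', Real.norm_eq_abs]

end
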